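/- arXiv:1307.3671 — 10 statements merged into one kernel-verified Lean document; each statement's English description precedes it below -/
import Mathlib

section
/- With A, λ, Q, R, μ_n and M(n) as in the Ablowitz–Ladik setting, define N_1(n) = [[(1/2)λ² − Q_n R_{n−1}, Q_n λ],[R_{n−1} λ, −(1/2)λ²]]. Then for every n ∈ ℤ: N_1(n+1)·M(n) − M(n)·N_1(n) = [[0, μ_n Q_{n+1}],[−μ_n R_{n−1}, 0]]. In other words, the first positive Ablowitz–Ladik flow Q_{n,t} = μ_n Q_{n+1}, R_{n,t} = −μ_n R_{n−1} admits the discrete zero curvature representation with spectral matrix M and time part N_1. -/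
/-- The Ablowitz–Ladik spectral matrix `M(n) = [[λ, Q_n],[R_n, λ⁻¹]]`. -/
def ALMat {A : Type*} [CommRing A] (lam lamInv : A) (Q R : ℤ → A) (n : ℤ) :
    Matrix (Fin 2) (Fin 2) A :=
  !![lam, Q n; R n, lamInv]

/-- `μ_n = 1 - Q_n R_n`. -/
def ALmu {A : Type*} [CommRing A] (Q R : ℤ → A) (n : ℤ) : A := 1 - Q n * R n

/-- Time part `N_1(n) = [[½λ² − Q_n R_{n−1}, Q_n λ],[R_{n−1} λ, −½λ²]]` of the first positive
Ablowitz–Ladik flow. -/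
def ALN1 {A : Type*} [CommRing A] [Invertible (2 : A)] (lam : A) (Q R : ℤ → A) (n : ℤ) :
    Matrix (Fin 2) (Fin 2) A :=
  !![⅟(2 : A) * lam ^ 2 - Q n * R (n - 1), Q n * lam;
     R (n - 1) * lam, -(⅟(2 : A) * lam ^ 2)]

/-- The first positive Ablowitz–Ladik flow `Q_{n,t} = μ_n Q_{n+1}`, `R_{n,t} = −μ_n R_{n−1}`
admits the discrete zero curvature representation
`N_1(n+1)·M(n) − M(n)·N_1(n) = [[0, μ_n Q_{n+1}],[−μ_n R_{n−1}, 0]]`. -/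
theorem AL_first_flow_zero_curvature {A : Type*} [CommRing A] [Invertible (2 : A)]
    (lam lamInv : A) (hlam : lam * lamInv = 1) (Q R : ℤ → A) :
    ∀ n : ℤ,
      ALN1 lam Q R (n + 1) * ALMat lam lamInv Q R n
          - ALMat lam lamInv Q R n * ALN1 lam Q R n =
        !![0, ALmu Q R n * Q (n + 1); -(ALmu Q R n * R (n - 1)), 0] := by
  intro n
  have half : (⅟2 : A) * 2 = 1 := invOf_mul_self 2
  ext i j
  fin_cases i <;> fin_cases j <;> simp [ALN1, ALMat, ALmu]
  · ring
  · linear_combination lam ^ 2 * Q n * half + Q (n + 1) * hlam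
  · linear_combination -(lam ^ 2 * R n) * half - R (n - 1) * hlam
  · ring
end

section
/- With A, λ, Q, R, μ_n and M(n) as in the Ablowitz–Ladik setting (and A a ℚ-algebra), define N_{A,1}(n) = (1/2)·[[(1/2)λ² − Q_n R_{n−1} − (1/2)λ^{−2}, Q_n λ + Q_{n−1} λ^{−1}],[R_{n−1} λ + R_n λ^{−1}, −(1/2)λ² − Q_{n−1} R_n + (1/2)λ^{−2}]]. Then for every n ∈ ℤ: N_{A,1}(n+1)·M(n) − M(n)·N_{A,1}(n) = [[0, (1/2)μ_n(Q_{n+1} − Q_{n−1})],[(1/2)μ_n(R_{n+1} − R_{n−1}), 0]]. In other words, the first semi-discrete AKNS flow Q_{n,t} = (1/2)μ_n(Q_{n+1} − Q_{n−1}), R_{n,t} = (1/2)μ_n(R_{n+1} − R_{n−1}) admits the discrete zero curvature representation with spectral matrix M and time part N_{A,1}. -/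
/-- Time part
`N_{A,1}(n) = ½·[[½λ² − Q_n R_{n−1} − ½λ⁻², Q_n λ + Q_{n−1} λ⁻¹],
               [R_{n−1} λ + R_n λ⁻¹, −½λ² − Q_{n−1} R_n + ½λ⁻²]]`
of the first semi-discrete AKNS flow. -/
def sdAKNSN1 {A : Type*} [CommRing A] [Invertible (2 : A)] (lam lamInv : A) (Q R : ℤ → A)
    (n : ℤ) : Matrix (Fin 2) (Fin 2) A :=
  ⅟(2 : A) •
    !![⅟(2 : A) * lam ^ 2 - Q n * R (n - 1) - ⅟(2 : A) * lamInv ^ 2,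
        Q n * lam + Q (n - 1) * lamInv;
       R (n - 1) * lam + R n * lamInv,
        -(⅟(2 : A) * lam ^ 2) - Q (n - 1) * R n + ⅟(2 : A) * lamInv ^ 2]

/-- The first semi-discrete AKNS flow `Q_{n,t} = ½μ_n(Q_{n+1} − Q_{n−1})`,
`R_{n,t} = ½μ_n(R_{n+1} − R_{n−1})` admits the discrete zero curvature representation with
spectral matrix `M` and time part `N_{A,1}`. -/
theorem sdAKNS_first_flow_zero_curvature {A : Type*} [CommRing A] [Algebra ℚ A]
    [Invertible (2 : A)] (lam lamInv : A) (hlam : lam * lamInv = 1) (Q R : ℤ → A) :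
    ∀ n : ℤ,
      sdAKNSN1 lam lamInv Q R (n + 1) * ALMat lam lamInv Q R n
          - ALMat lam lamInv Q R n * sdAKNSN1 lam lamInv Q R n =
        !![0, ⅟(2 : A) * ALmu Q R n * (Q (n + 1) - Q (n - 1));
           ⅟(2 : A) * ALmu Q R n * (R (n + 1) - R (n - 1)), 0] := by
  intro n
  have h2 : ⅟(2 : A) * 2 = 1 := invOf_mul_self 2
  ext i j
  fin_cases i <;> fin_cases j <;>
    simp [sdAKNSN1, ALMat, ALmu]
  · ring
  · linear_combination ⅟(2 : A) * (Q n * (lam ^ 2 - lamInv ^ 2)) * h2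
      + ⅟(2 : A) * (Q (n + 1) - Q (n - 1)) * hlam
  · linear_combination ⅟(2 : A) * (R n * (lamInv ^ 2 - lam ^ 2)) * h2
      + ⅟(2 : A) * (R (n + 1) - R (n - 1)) * hlam
  · ring
end

section
/- With A, λ, Q, R, μ_n and M(n) as in the Ablowitz–Ladik setting, define N_{A,2}(n) = [[(1/2)λ² − (1 + Q_n R_{n−1}) + (1/2)λ^{−2}, Q_n λ − Q_{n−1} λ^{−1}],[R_{n−1} λ − R_n λ^{−1}, −(1/2)λ² + (1 + Q_{n−1} R_n) − (1/2)λ^{−2}]]. Then for every n ∈ ℤ: N_{A,2}(n+1)·M(n) − M(n)·N_{A,2}(n) = [[0, Q_{n+1} − 2Q_n + Q_{n−1} − Q_n R_n (Q_{n+1} + Q_{n−1})],[−R_{n+1} + 2R_n − R_{n−1} + Q_n R_n (R_{n+1} + R_{n−1}), 0]]. In other words, the second semi-discrete AKNS flow (the semi-discrete NLS-type flow) Q_{n,t} = Q_{n+1} − 2Q_n + Q_{n−1} − Q_n R_n (Q_{n+1} + Q_{n−1}), R_{n,t} = −R_{n+1} + 2R_n − R_{n−1} + Q_n R_n (R_{n+1}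 + R_{n−1}) admits the discrete zero curvature representation with spectral matrix M and time part N_{A,2}. -/
/-- Time part
`N_{A,2}(n) = [[½λ² − (1 + Q_n R_{n−1}) + ½λ⁻², Q_n λ − Q_{n−1} λ⁻¹],
              [R_{n−1} λ − R_n λ⁻¹, −½λ² + (1 + Q_{n−1} R_n) − ½λ⁻²]]`
of the second semi-discrete AKNS flow. -/
def sdAKNSN2 {A : Type*} [CommRing A] [Invertible (2 : A)] (lam lamInv : A) (Q R : ℤ → A)
    (n : ℤ) : Matrix (Fin 2) (Fin 2) A :=
  !![⅟(2 : A) * lam ^ 2 - (1 + Q n * R (n - 1)) + ⅟(2 : A) * lamInv ^ 2,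
      Q n * lam - Q (n - 1) * lamInv;
     R (n - 1) * lam - R n * lamInv,
      -(⅟(2 : A) * lam ^ 2) + (1 + Q (n - 1) * R n) - ⅟(2 : A) * lamInv ^ 2]

/-- The second semi-discrete AKNS (semi-discrete NLS-type) flow
`Q_{n,t} = Q_{n+1} − 2Q_n + Q_{n−1} − Q_n R_n (Q_{n+1} + Q_{n−1})`,
`R_{n,t} = −R_{n+1} + 2R_n − R_{n−1} + Q_n R_n (R_{n+1} + R_{n−1})`
admits the discrete zero curvature representation with spectral matrix `M` and time part
`N_{A,2}`. -/
theorem sdAKNS_second_flow_zero_curvature {A : Type*} [CommRing A] [Invertible (2 : A)]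
    (lam lamInv : A) (hlam : lam * lamInv = 1) (Q R : ℤ → A) :
    ∀ n : ℤ,
      sdAKNSN2 lam lamInv Q R (n + 1) * ALMat lam lamInv Q R n
          - ALMat lam lamInv Q R n * sdAKNSN2 lam lamInv Q R n =
        !![0, Q (n + 1) - 2 * Q n + Q (n - 1) - Q n * R n * (Q (n + 1) + Q (n - 1));
           -R (n + 1) + 2 * R n - R (n - 1) + Q n * R n * (R (n + 1) + R (n - 1)), 0] := by
  intro n
  have h2 : ⅟(2 : A) * 2 = 1 := invOf_mul_self 2
  ext i j
  fin_cases i <;> fin_cases j <;>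
    simp only [sdAKNSN2, ALMat, Matrix.sub_apply, Matrix.mul_apply, Fin.sum_univ_two,
      Matrix.of_apply, Matrix.cons_val', Matrix.cons_val_zero, Matrix.cons_val_one,
      Matrix.cons_val_fin_one, Fin.zero_eta, Fin.mk_one, Fin.isValue, add_sub_cancel_right]
  · ring
  · linear_combination Q n * (lam ^ 2 + lamInv ^ 2) * h2 + (Q (n + 1) + Q (n - 1)) * hlam
  · linear_combination -(R n * (lam ^ 2 + lamInv ^ 2)) * h2 - (R (n + 1) + R (n - 1)) * hlam
  · ring
end

section
/- Let q, r : ℝ² → ℂ be infinitely differentiable functions of (x, t) and let η ∈ ℂ. Set M = [[η, q],[r, −η]] and N_2 = [[2η² − q r, 2η q + q_x],[2η r − r_x, −2η² + q r]]. Then the zero curvature equation ∂_t M − ∂_x N_2 + M N_2 − N_2 M = 0 holds at every point of ℝ² if and only if q_t = q_{xx} − 2q²r and r_t = −r_{xx} + 2q r² hold at every point of ℝ². -/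
/-- Partial derivative in the first (spatial) variable `x`. -/
noncomputable def pdx (f : ℝ → ℝ → ℂ) : ℝ → ℝ → ℂ := fun x t => deriv (fun x' => f x' t) x

/-- Partial derivative in the second (temporal) variable `t`. -/
noncomputable def pdt (f : ℝ → ℝ → ℂ) : ℝ → ℝ → ℂ := fun x t => deriv (fun t' => f x t') t

/-- Entrywise partial `x`-derivative of a matrix-valued function. -/
noncomputable def mpdx (F : ℝ → ℝ → Matrix (Fin 2) (Fin 2) ℂ) :
    ℝ → ℝ → Matrix (Fin 2) (Fin 2) ℂ :=
  fun x t => Matrix.of fun i j => deriv (fun x' => F x' t i j) x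

/-- Entrywise partial `t`-derivative of a matrix-valued function. -/
noncomputable def mpdt (F : ℝ → ℝ → Matrix (Fin 2) (Fin 2) ℂ) :
    ℝ → ℝ → Matrix (Fin 2) (Fin 2) ℂ :=
  fun x t => Matrix.of fun i j => deriv (fun t' => F x t' i j) t

/-- The AKNS spectral matrix `M = [[η, q],[r, −η]]`. -/
noncomputable def AKNSM (η : ℂ) (q r : ℝ → ℝ → ℂ) : ℝ → ℝ → Matrix (Fin 2) (Fin 2) ℂ :=
  fun x t => !![η, q x t; r x t, -η]

/-- The second AKNS time part `N₂ = [[2η² − qr, 2ηq + q_x],[2ηr − r_x, −2η² + qr]]`. -/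
noncomputable def AKNSN2 (η : ℂ) (q r : ℝ → ℝ → ℂ) : ℝ → ℝ → Matrix (Fin 2) (Fin 2) ℂ :=
  fun x t =>
    !![2 * η ^ 2 - q x t * r x t, 2 * η * q x t + pdx q x t;
       2 * η * r x t - pdx r x t, -(2 * η ^ 2) + q x t * r x t]

theorem contDiff_slice {f : ℝ → ℝ → ℂ}
    (hf : ContDiff ℝ (⊤ : ℕ∞) fun p : ℝ × ℝ => f p.1 p.2) (t : ℝ) :
    ContDiff ℝ (⊤ : ℕ∞) fun x => f x t :=
  hf.comp (contDiff_id.prodMk contDiff_const)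

theorem hasDerivAt_pdx {f : ℝ → ℝ → ℂ}
    (hf : ContDiff ℝ (⊤ : ℕ∞) fun p : ℝ × ℝ => f p.1 p.2) (x t : ℝ) :
    HasDerivAt (fun x' => f x' t) (pdx f x t) x :=
  ((contDiff_slice hf t).differentiable (by simp) x).hasDerivAt

theorem hasDerivAt_pdx_pdx {f : ℝ → ℝ → ℂ}
    (hf : ContDiff ℝ (⊤ : ℕ∞) fun p : ℝ × ℝ => f p.1 p.2) (x t : ℝ) :
    HasDerivAt (fun x' => pdx f x' t) (pdx (pdx f) x t) x :=
  (((contDiff_infty_iff_deriv.1 (contDiff_slice hf t)).2).differentiable (by simp) x).hasDerivAt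

theorem mpdt_AKNSM (η : ℂ) (q r : ℝ → ℝ → ℂ) (x t : ℝ) :
    mpdt (AKNSM η q r) x t = !![0, pdt q x t; pdt r x t, 0] := by
  ext i j
  fin_cases i <;> fin_cases j <;> simp [mpdt, AKNSM, pdt]

theorem mpdx_AKNSN2 (η : ℂ) {q r : ℝ → ℝ → ℂ}
    (hq : ContDiff ℝ (⊤ : ℕ∞) fun p : ℝ × ℝ => q p.1 p.2)
    (hr : ContDiff ℝ (⊤ : ℕ∞) fun p : ℝ × ℝ => r p.1 p.2) (x t : ℝ) :
    mpdx (AKNSN2 η q r) x t =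
      !![-(pdx q x t * r x t + q x t * pdx r x t), 2 * η * pdx q x t + pdx (pdx q) x t;
         2 * η * pdx r x t - pdx (pdx r) x t, pdx q x t * r x t + q x t * pdx r x t] := by
  have hqx := hasDerivAt_pdx hq x t
  have hrx := hasDerivAt_pdx hr x t
  ext i j
  fin_cases i <;> fin_cases j
  · exact ((hqx.mul hrx).const_sub (2 * η ^ 2)).deriv
  · exact ((hqx.const_mul (2 * η)).add (hasDerivAt_pdx_pdx hq x t)).deriv
  · exact ((hrx.const_mul (2 * η)).sub (hasDerivAt_pdx_pdx hr x t)).deriv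
  · exact ((hqx.mul hrx).const_add (-(2 * η ^ 2))).deriv

theorem AKNS2_curvature_eq (η : ℂ) {q r : ℝ → ℝ → ℂ}
    (hq : ContDiff ℝ (⊤ : ℕ∞) fun p : ℝ × ℝ => q p.1 p.2)
    (hr : ContDiff ℝ (⊤ : ℕ∞) fun p : ℝ × ℝ => r p.1 p.2) (x t : ℝ) :
    mpdt (AKNSM η q r) x t - mpdx (AKNSN2 η q r) x t
        + AKNSM η q r x t * AKNSN2 η q r x t
        - AKNSN2 η q r x t * AKNSM η q r x t =
      !![0, pdt q x t - (pdx (pdx q) x t - 2 * q x t ^ 2 * r x t);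
         pdt r x t - (-(pdx (pdx r) x t) + 2 * q x t * r x t ^ 2), 0] := by
  rw [mpdt_AKNSM, mpdx_AKNSN2 η hq hr]
  ext i j
  fin_cases i <;> fin_cases j <;>
    simp [AKNSM, AKNSN2] <;> ring

/-- For smooth `q, r`, the zero curvature equation `∂_t M − ∂_x N₂ + M N₂ − N₂ M = 0` holds
everywhere iff `q_t = q_{xx} − 2q²r` and `r_t = −r_{xx} + 2qr²` hold everywhere. -/
theorem AKNS2_zero_curvature_iff (η : ℂ) (q r : ℝ → ℝ → ℂ)
    (hq : ContDiff ℝ (⊤ : ℕ∞) fun p : ℝ × ℝ => q p.1 p.2)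
    (hr : ContDiff ℝ (⊤ : ℕ∞) fun p : ℝ × ℝ => r p.1 p.2) :
    (∀ x t : ℝ,
        mpdt (AKNSM η q r) x t - mpdx (AKNSN2 η q r) x t
            + AKNSM η q r x t * AKNSN2 η q r x t
            - AKNSN2 η q r x t * AKNSM η q r x t = 0)
      ↔ (∀ x t : ℝ,
          pdt q x t = pdx (pdx q) x t - 2 * q x t ^ 2 * r x t ∧
          pdt r x t = -(pdx (pdx r) x t) + 2 * q x t * r x t ^ 2) := by
  refine forall₂_congr fun x t => ?_
  rw [AKNS2_curvature_eq η hq hr, ← Matrix.ext_iff]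
  simp [Fin.forall_fin_two, sub_eq_zero]
end

section
/- Let η ∈ ℂ and let q, φ : ℝ² → ℂ be infinitely differentiable functions of (x, t) satisfying, at every point of ℝ², the scalar Lax pair φ_{xx} = (η² − q)φ and φ_t = −q_x φ + (4η² + 2q) φ_x. Then at every point of ℝ², (q_t − q_{xxx} − 6 q q_x)·φ = 0. In particular, at every point where φ ≠ 0, q satisfies the KdV equation q_t = q_{xxx} + 6 q q_x. -/
/-- The partial derivative in `x` is the Fréchet derivative in the direction `(1, 0)`. -/
theorem hasDerivAt_fst_slice {f : ℝ → ℝ → ℂ}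
    (hf : ContDiff ℝ (⊤ : ℕ∞) fun p : ℝ × ℝ => f p.1 p.2) (x t : ℝ) :
    HasDerivAt (fun x' => f x' t) (fderiv ℝ (fun p : ℝ × ℝ => f p.1 p.2) (x, t) (1, 0)) x :=
  ((hf.differentiable (by simp)) (x, t)).hasFDerivAt.comp_hasDerivAt (f := fun x' => (x', t)) x
    ((hasDerivAt_id x).prodMk (hasDerivAt_const x t))

/-- The partial derivative in `t` is the Fréchet derivative in the direction `(0, 1)`. -/
theorem hasDerivAt_snd_slice {f : ℝ → ℝ → ℂ}
    (hf : ContDiff ℝ (⊤ : ℕ∞) fun p : ℝ × ℝ => f p.1 p.2) (x t : ℝ) :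
    HasDerivAt (fun t' => f x t') (fderiv ℝ (fun p : ℝ × ℝ => f p.1 p.2) (x, t) (0, 1)) t :=
  ((hf.differentiable (by simp)) (x, t)).hasFDerivAt.comp_hasDerivAt (f := fun t' => (x, t')) t
    ((hasDerivAt_const t x).prodMk (hasDerivAt_id t))

theorem hasDerivAt_pdt {f : ℝ → ℝ → ℂ}
    (hf : ContDiff ℝ (⊤ : ℕ∞) fun p : ℝ × ℝ => f p.1 p.2) (x t : ℝ) :
    HasDerivAt (fun t' => f x t') (pdt f x t) t :=
  (hasDerivAt_snd_slice hf x t).differentiableAt.hasDerivAt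

theorem pdx_eq_fderiv {f : ℝ → ℝ → ℂ}
    (hf : ContDiff ℝ (⊤ : ℕ∞) fun p : ℝ × ℝ => f p.1 p.2) (x t : ℝ) :
    pdx f x t = fderiv ℝ (fun p : ℝ × ℝ => f p.1 p.2) (x, t) (1, 0) :=
  (hasDerivAt_fst_slice hf x t).deriv

theorem pdt_eq_fderiv {f : ℝ → ℝ → ℂ}
    (hf : ContDiff ℝ (⊤ : ℕ∞) fun p : ℝ × ℝ => f p.1 p.2) (x t : ℝ) :
    pdt f x t = fderiv ℝ (fun p : ℝ × ℝ => f p.1 p.2) (x, t) (0, 1) :=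
  (hasDerivAt_snd_slice hf x t).deriv

theorem contDiff_pdx {f : ℝ → ℝ → ℂ}
    (hf : ContDiff ℝ (⊤ : ℕ∞) fun p : ℝ × ℝ => f p.1 p.2) :
    ContDiff ℝ (⊤ : ℕ∞) fun p : ℝ × ℝ => pdx f p.1 p.2 := by
  simp only [pdx_eq_fderiv hf]
  exact (hf.fderiv_right (by simp)).clm_apply contDiff_const

theorem contDiff_pdt {f : ℝ → ℝ → ℂ}
    (hf : ContDiff ℝ (⊤ : ℕ∞) fun p : ℝ × ℝ => f p.1 p.2) :
    ContDiff ℝ (⊤ : ℕ∞) fun p : ℝ × ℝ => pdt f p.1 p.2 := by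
  simp only [pdt_eq_fderiv hf]
  exact (hf.fderiv_right (by simp)).clm_apply contDiff_const

/-- The mixed partial derivatives of a smooth function agree. -/
theorem pdx_pdt_comm {f : ℝ → ℝ → ℂ}
    (hf : ContDiff ℝ (⊤ : ℕ∞) fun p : ℝ × ℝ => f p.1 p.2) (x t : ℝ) :
    pdx (pdt f) x t = pdt (pdx f) x t := by
  have hd : DifferentiableAt ℝ (fderiv ℝ fun p : ℝ × ℝ => f p.1 p.2) (x, t) :=
    (hf.fderiv_right (m := (⊤ : ℕ∞)) (by simp)).differentiable (by simp) (x, t)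
  have hs : IsSymmSndFDerivAt ℝ (fun p : ℝ × ℝ => f p.1 p.2) (x, t) :=
    hf.contDiffAt.isSymmSndFDerivAt (by
      rw [minSmoothness_of_isRCLikeNormedField]
      exact WithTop.coe_le_coe.2 (le_top : (2 : ℕ∞) ≤ ⊤))
  rw [pdx_eq_fderiv (contDiff_pdt hf), pdt_eq_fderiv (contDiff_pdx hf)]
  simp only [pdx_eq_fderiv hf, pdt_eq_fderiv hf, Prod.mk.eta]
  rw [fderiv_clm_apply hd (differentiableAt_const _),
    fderiv_clm_apply hd (differentiableAt_const _)]
  simpa using hs.eq (1, 0) (0, 1)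

/-- If smooth `q, φ` satisfy the scalar KdV Lax pair `φ_{xx} = (η² − q)φ` and
`φ_t = −q_x φ + (4η² + 2q) φ_x` at every point, then `(q_t − q_{xxx} − 6qq_x)·φ = 0`
everywhere; in particular `q` satisfies the KdV equation `q_t = q_{xxx} + 6qq_x` at every
point where `φ ≠ 0`. -/
theorem KdV_scalar_lax (η : ℂ) (q φ : ℝ → ℝ → ℂ)
    (hq : ContDiff ℝ (⊤ : ℕ∞) fun p : ℝ × ℝ => q p.1 p.2)
    (hφ : ContDiff ℝ (⊤ : ℕ∞) fun p : ℝ × ℝ => φ p.1 p.2)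
    (hLax1 : ∀ x t : ℝ, pdx (pdx φ) x t = (η ^ 2 - q x t) * φ x t)
    (hLax2 : ∀ x t : ℝ,
      pdt φ x t = -(pdx q x t) * φ x t + (4 * η ^ 2 + 2 * q x t) * pdx φ x t) :
    (∀ x t : ℝ,
        (pdt q x t - pdx (pdx (pdx q)) x t - 6 * q x t * pdx q x t) * φ x t = 0) ∧
    (∀ x t : ℝ, φ x t ≠ 0 →
        pdt q x t = pdx (pdx (pdx q)) x t + 6 * q x t * pdx q x t) := by
  have key : ∀ x t : ℝ,
      (pdt q x t - pdx (pdx (pdx q)) x t - 6 * q x t * pdx q x t) * φ x t = 0 := by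
    have hq₁ := contDiff_pdx hq
    have hq₂ := contDiff_pdx hq₁
    have hφ₁ := contDiff_pdx hφ
    have hφ_xx : ∀ x t, HasDerivAt (fun x' => pdx φ x' t) ((η ^ 2 - q x t) * φ x t) x :=
      fun x t => hLax1 x t ▸ hasDerivAt_pdx hφ₁ x t
    have hφ_tx : ∀ x t, pdx (pdt φ) x t =
        -(pdx (pdx q) x t) * φ x t + pdx q x t * pdx φ x t +
          (4 * η ^ 2 + 2 * q x t) * ((η ^ 2 - q x t) * φ x t) := by
      intro x t
      have h := ((hasDerivAt_pdx hq₁ x t).fun_neg.fun_mul (hasDerivAt_pdx hφ x t)).fun_add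
        ((((hasDerivAt_pdx hq x t).const_mul 2).const_add (4 * η ^ 2)).fun_mul (hφ_xx x t))
      simp only [← hLax2] at h
      exact h.deriv.trans (by ring)
    intro x t
    have hφ_txx : pdx (pdx (pdt φ)) x t =
        -(pdx (pdx (pdx q)) x t) * φ x t + 3 * pdx q x t * ((η ^ 2 - q x t) * φ x t) -
          (4 * η ^ 2 + 2 * q x t) * pdx q x t * φ x t +
          (4 * η ^ 2 + 2 * q x t) * (η ^ 2 - q x t) * pdx φ x t := by
      have h := (((hasDerivAt_pdx hq₂ x t).fun_neg.fun_mul (hasDerivAt_pdx hφ x t)).fun_add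
        ((hasDerivAt_pdx hq₁ x t).fun_mul (hφ_xx x t))).fun_add
        ((((hasDerivAt_pdx hq x t).const_mul 2).const_add (4 * η ^ 2)).fun_mul
          (((hasDerivAt_pdx hq x t).const_sub (η ^ 2)).fun_mul (hasDerivAt_pdx hφ x t)))
      simp only [← hφ_tx] at h
      exact h.deriv.trans (by ring)
    have hφ_xxt : pdt (pdx (pdx φ)) x t =
        -(pdt q x t) * φ x t + (η ^ 2 - q x t) * pdt φ x t := by
      have h := ((hasDerivAt_pdt hq x t).const_sub (η ^ 2)).fun_mul (hasDerivAt_pdt hφ x t)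
      simp only [← hLax1] at h
      exact h.deriv
    have hcomm : pdx (pdx (pdt φ)) x t = pdt (pdx (pdx φ)) x t := by
      rw [← pdx_pdt_comm hφ₁, funext₂ (pdx_pdt_comm hφ)]
    rw [hφ_txx, hφ_xxt, hLax2] at hcomm
    linear_combination hcomm
  refine ⟨key, fun x t hne => ?_⟩
  linear_combination (mul_eq_zero.mp (key x t)).resolve_right hne
end

section
/- Let q, r : ℝ → ℂ be infinitely differentiable and fix x ∈ ℝ. Then as h → 0: h·[q(x+h) − 2q(x) + q(x−h)] − h³·q(x)r(x)·[q(x+h) + q(x−h)] − (q''(x) − 2q(x)²r(x))·h³ = O(h⁴), and −h·[r(x+h) − 2r(x) + r(x−h)] + h³·q(x)r(x)·[r(x+h) + r(x−h)] − (−r''(x) + 2q(x)r(x)²)·h³ = O(h⁴). That is, in the continuum limit the second semi-discrete AKNS flow K̄_{A,2} (with Q_n = h q(x+nh), R_n = h r(x+nh)) satisfies K̄_{A,2} = (q_{xx} − 2q²r, −r_{xx} + 2qr²)·h³ + O(h⁴). -/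
open Asymptotics Topology

/-- The symmetric second difference agrees with `h² f''` up to `o(h³)`. -/
theorem isLittleO_second_difference_sub {f : ℝ → ℂ} (hf : ContDiff ℝ 3 f) (x : ℝ) :
    (fun h : ℝ => f (x + h) - 2 * f x + f (x - h) - deriv (deriv f) x * (h : ℂ) ^ 2)
      =o[𝓝 (0 : ℝ)] fun h : ℝ => h ^ 3 := by
  have taylor : (fun y => f y - taylorWithinEval f 3 Set.univ x y)
      =o[𝓝 x] fun y => (y - x) ^ 3 := taylor_isLittleO_univ hf
  have tendsto_add : Filter.Tendsto (fun h : ℝ => x + h) (𝓝 0) (𝓝 x) :=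
    Continuous.tendsto' (by fun_prop) _ _ (by simp)
  have tendsto_sub : Filter.Tendsto (fun h : ℝ => x - h) (𝓝 0) (𝓝 x) :=
    Continuous.tendsto' (by fun_prop) _ _ (by simp)
  have forward := taylor.comp_tendsto tendsto_add
  have backward := taylor.comp_tendsto tendsto_sub
  have forward' : _ =o[𝓝 (0 : ℝ)] fun h : ℝ => h ^ 3 :=
    forward.congr_right fun h => by simp
  have backward' : _ =o[𝓝 (0 : ℝ)] fun h : ℝ => h ^ 3 :=
    (backward.neg_right).congr_right fun h => by simp only [Function.comp_apply]; ring
  refine (forward'.add backward').congr_left fun h => ?_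
  simp only [Function.comp_apply, taylorWithinEval_succ, taylor_within_zero_eval,
    iteratedDerivWithin_univ, iteratedDeriv_succ, iteratedDeriv_zero, Complex.real_smul]
  push_cast
  norm_num [Nat.factorial]
  ring

/-- Each component of the second semi-discrete AKNS flow, with the value `c` of the product of the
two potentials held fixed. -/
theorem isBigO_second_flow_component {f : ℝ → ℂ} (hf : ContDiff ℝ 3 f) (c : ℂ) (x : ℝ) :
    (fun h : ℝ => (h : ℂ) * (f (x + h) - 2 * f x + f (x - h))
        - (h : ℂ) ^ 3 * c * (f (x + h) + f (x - h))
        - (deriv (deriv f) x - 2 * c * f x) * (h : ℂ) ^ 3)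
      =O[𝓝 (0 : ℝ)] fun h : ℝ => h ^ 4 := by
  have remainder := (isLittleO_second_difference_sub hf x).isBigO
  have ofReal_isBigO (n : ℕ) : (fun h : ℝ => (h : ℂ) ^ n) =O[𝓝 (0 : ℝ)] fun h : ℝ => h ^ n :=
    isBigO_of_le _ fun h => by simp
  have difference : (fun h : ℝ => f (x + h) - 2 * f x + f (x - h))
      =O[𝓝 (0 : ℝ)] fun h : ℝ => h ^ 1 :=
    ((remainder.trans (isLittleO_pow_pow (by norm_num)).isBigO).add
      (((ofReal_isBigO 2).const_mul_left (deriv (deriv f) x)).trans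
        (isLittleO_pow_pow (by norm_num)).isBigO)).congr_left fun h => by ring
  have linear : _ =O[𝓝 (0 : ℝ)] fun h : ℝ => h ^ 4 :=
    ((ofReal_isBigO 1).mul remainder).congr_right fun h => by ring
  have nonlinear : _ =O[𝓝 (0 : ℝ)] fun h : ℝ => h ^ 4 :=
    (((ofReal_isBigO 3).mul difference).const_mul_left c).congr_right fun h => by ring
  exact (linear.sub nonlinear).congr_left fun h => by ring

/-- Continuum limit of the second semi-discrete AKNS flow: with `Q_n = h q(x+nh)`,
`R_n = h r(x+nh)`, the flow `K̄_{A,2}` satisfies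
`K̄_{A,2} = (q_{xx} − 2q²r, −r_{xx} + 2qr²) h³ + O(h⁴)` as `h → 0`. -/
theorem sdAKNS_second_flow_continuum_limit (q r : ℝ → ℂ)
    (hq : ContDiff ℝ (⊤ : ℕ∞) q) (hr : ContDiff ℝ (⊤ : ℕ∞) r) (x : ℝ) :
    ((fun h : ℝ =>
        (h : ℂ) * (q (x + h) - 2 * q x + q (x - h))
          - (h : ℂ) ^ 3 * q x * r x * (q (x + h) + q (x - h))
          - (deriv (deriv q) x - 2 * q x ^ 2 * r x) * (h : ℂ) ^ 3)
        =O[𝓝 (0 : ℝ)] fun h : ℝ => h ^ 4)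
    ∧ ((fun h : ℝ =>
        -((h : ℂ) * (r (x + h) - 2 * r x + r (x - h)))
          + (h : ℂ) ^ 3 * q x * r x * (r (x + h) + r (x - h))
          - (-(deriv (deriv r) x) + 2 * q x * r x ^ 2) * (h : ℂ) ^ 3)
        =O[𝓝 (0 : ℝ)] fun h : ℝ => h ^ 4) := by
  have hq3 : ContDiff ℝ 3 q := contDiff_infty.1 hq 3
  have hr3 : ContDiff ℝ 3 r := contDiff_infty.1 hr 3
  exact ⟨(isBigO_second_flow_component hq3 (q x * r x) x).congr_left fun h => by ring,
    (isBigO_second_flow_component hr3 (q x * r x) x).neg_left.congr_left fun h => by ring⟩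
end

section
/- Let q : ℝ → ℝ be infinitely differentiable and fix x ∈ ℝ. For each h define G_h(y) = h²·[q(y+h) − 2q(y) + q(y−h)] + h⁴·q(y)·[q(y+h) + q(y) + q(y−h)]. Then as h → 0: (1/2)·(1 + h²q(x))·(G_h(x+h) − G_h(x−h)) − (q'''(x) + 6q(x)q'(x))·h⁵ = O(h⁶). That is, the right-hand side of the semi-discrete KdV equation Q_{n,t} = (1/2)(1+Q_n)(E − E^{-1})[Q_{n+1} − 2Q_n + Q_{n−1} + Q_n(Q_{n+1} + Q_n + Q_{n−1})], with Q_n = h²q(x+nh), equals (q_{xxx} + 6qq_x)h⁵ + O(h⁶), so in the continuum limit the semi-discrete KdV equation goes to the KdV equation q_t = q_{xxx} + 6qq_x. -/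
open Asymptotics Topology

/-- `G_h(y) = h²[q(y+h) − 2q(y) + q(y−h)] + h⁴ q(y)[q(y+h) + q(y) + q(y−h)]`, the bracket in
the right-hand side of the semi-discrete KdV equation with `Q_n = h² q(x+nh)`. -/
noncomputable def sdKdVG (q : ℝ → ℝ) (h y : ℝ) : ℝ :=
  h ^ 2 * (q (y + h) - 2 * q y + q (y - h))
    + h ^ 4 * q y * (q (y + h) + q y + q (y - h))

/-- **Taylor's theorem** in Peano form with a remainder factor continuous at the base point. -/
theorem exists_continuousAt_taylor_remainder {f : ℝ → ℝ} {n : ℕ} (hf : ContDiff ℝ n f) (x : ℝ) :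
    ∃ r : ℝ → ℝ, ContinuousAt r 0 ∧
      ∀ t, f (x + t) = taylorWithinEval f n Set.univ x (x + t) + t ^ n * r t := by
  have hadd : Filter.Tendsto (fun t : ℝ => x + t) (𝓝 0) (𝓝 x) := by
    simpa using (continuous_const_add x).tendsto 0
  have ho := (taylor_isLittleO_univ (x₀ := x) hf).comp_tendsto hadd
  refine ⟨fun t => (f (x + t) - taylorWithinEval f n Set.univ x (x + t)) / t ^ n, ?_, fun t => ?_⟩
  · have h0 := ho.tendsto_div_nhds_zero
    simpa [ContinuousAt, Function.comp_def] using h0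
  · rcases eq_or_ne t 0 with rfl | ht
    · simp
    · field_simp
      ring

/-- A smooth function agrees with its cubic Taylor polynomial up to `t ^ 4` times a factor that is
continuous at `0`. -/
theorem exists_cubic_taylor_remainder {q : ℝ → ℝ} (hq : ContDiff ℝ 4 q) (x : ℝ) :
    ∃ (c : ℝ) (R : ℝ → ℝ), ContinuousAt R 0 ∧
      ∀ t, q (x + t) = q x + deriv q x * t + c * t ^ 2 + iteratedDeriv 3 q x / 6 * t ^ 3
        + t ^ 4 * R t := by
  obtain ⟨r, hr, hT⟩ := exists_continuousAt_taylor_remainder (n := 4) (by exact_mod_cast hq) x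
  refine ⟨iteratedDeriv 2 q x / 2, fun t => iteratedDeriv 4 q x / 24 + r t,
    continuousAt_const.add hr, fun t => ?_⟩
  rw [hT t]
  simp [taylorWithinEval_succ, taylor_within_zero_eval, iteratedDerivWithin_univ,
    iteratedDeriv_one, Nat.factorial]
  ring

/-- Continuum limit of the semi-discrete KdV equation: with `Q_n = h² q(x+nh)`, the
right-hand side `½(1 + Q_n)(E − E⁻¹)[Q_{n+1} − 2Q_n + Q_{n−1} + Q_n(Q_{n+1} + Q_n + Q_{n−1})]`
equals `(q_{xxx} + 6qq_x) h⁵ + O(h⁶)` as `h → 0`. -/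
theorem sdKdV_continuum_limit (q : ℝ → ℝ) (hq : ContDiff ℝ (⊤ : ℕ∞) q) (x : ℝ) :
    (fun h : ℝ =>
        (1 / 2) * (1 + h ^ 2 * q x) * (sdKdVG q h (x + h) - sdKdVG q h (x - h))
          - (iteratedDeriv 3 q x + 6 * q x * deriv q x) * h ^ 5)
      =O[𝓝 (0 : ℝ)] fun h : ℝ => h ^ 6 := by
  obtain ⟨c, R, hR, hT⟩ :=
    exists_cubic_taylor_remainder (contDiff_infty.mp hq 4) x
  set a := q x
  set b := deriv q x
  obtain ⟨d, hd⟩ : ∃ d, iteratedDeriv 3 q x = 6 * d := ⟨iteratedDeriv 3 q x / 6, by ring⟩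
  rw [hd] at hT ⊢
  let S : ℝ → ℝ := fun h => 16 * R (2 * h) - 2 * R h + 2 * R (-1 * h) - 16 * R (-2 * h)
  let u : ℝ → ℝ → ℝ := fun k h => k ^ 2 * c + k ^ 3 * d * h + k ^ 4 * h ^ 2 * R (k * h)
  let W : ℝ → ℝ → ℝ := fun k h =>
    (a + k * b * h) * (u k h + u (2 * k) h)
      + u k h * (3 * a + 3 * k * b * h + h ^ 2 * (u k h + u (2 * k) h))
  let P : ℝ → ℝ := fun h =>
    (S h + (W 1 h - W (-1) h)) / 2 * (1 + a * h ^ 2) + a * h * (6 * d + 6 * a * b)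
  have hRk (k : ℝ) : ContinuousAt (fun h => R (k * h)) 0 :=
    ContinuousAt.comp' (by simpa using hR) (by fun_prop)
  have hu (k : ℝ) : ContinuousAt (u k) 0 :=
    ContinuousAt.add (by fun_prop) (ContinuousAt.mul (by fun_prop) (hRk k))
  have hW (k : ℝ) : ContinuousAt (W k) 0 := by
    have := hu k
    have := hu (2 * k)
    simp only [W]
    fun_prop
  have hS : ContinuousAt S 0 :=
    (((continuousAt_const.mul (hRk 2)).sub (continuousAt_const.mul hR)).add
      (continuousAt_const.mul (hRk (-1)))).sub (continuousAt_const.mul (hRk (-2)))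
  have hP : ContinuousAt P 0 := by
    have := hW 1
    have := hW (-1)
    simp only [P]
    fun_prop
  have hfactor : (fun h : ℝ =>
        (1 / 2) * (1 + h ^ 2 * a) * (sdKdVG q h (x + h) - sdKdVG q h (x - h))
          - (6 * d + 6 * a * b) * h ^ 5) = fun h => h ^ 6 * P h := by
    funext h
    have h1 := hT (1 * h)
    have h2 := hT (2 * h)
    have h3 := hT (-1 * h)
    have h4 := hT (-2 * h)
    rw [show x + 1 * h = x + h by ring] at h1
    rw [show x + 2 * h = x + h + h by ring] at h2
    rw [show x + -1 * h = x - h by ring] at h3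
    rw [show x + -2 * h = x - h - h by ring] at h4
    simp only [sdKdVG, add_sub_cancel_right, sub_add_cancel, h1, h2, h3, h4, P, W, S, u]
    norm_num
    ring
  rw [hfactor]
  simpa using (isBigO_refl (fun h : ℝ => h ^ 6) (𝓝 0)).mul (hP.tendsto.isBigO_one ℝ)
end

section
/- Let q : ℝ → ℝ be infinitely differentiable, fix x ∈ ℝ, and fix a sign ε ∈ {+1, −1}. For each h define P_h(y) = h·[q(y+h) − 2q(y) + q(y−h)] + ε·h³·q(y)²·[q(y+h) + q(y−h)]. Then as h → 0: (1/2)·(1 + ε·h²q(x)²)·(P_h(x+h) − P_h(x−h)) − (q'''(x) + 6ε·q(x)²q'(x))·h⁴ = O(h⁵). That is, the right-hand side of the semi-discrete mKdV equation Q_{n,t} = (1/2)(1 ± Q_n²)(E − E^{-1})[Q_{n+1} − 2Q_n + Q_{n−1} ± Q_n²(Q_{n+1} + Q_{n−1})], with Q_n = h q(x+nh), equals (q_{xxx} ± 6q²q_x)h⁴ + O(h⁵), so in the continuum limit the semi-discrete mKdV equation goes to the mKdV equation q_t = q_{xxx} ± 6q²q_x. -/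
open Asymptotics Topology

/-- `P_h(y) = h[q(y+h) − 2q(y) + q(y−h)] + ε h³ q(y)²[q(y+h) + q(y−h)]`, the bracket in the
right-hand side of the semi-discrete mKdV equation with sign `ε` and `Q_n = h q(x+nh)`. -/
noncomputable def sdmKdVP (ε : ℝ) (q : ℝ → ℝ) (h y : ℝ) : ℝ :=
  h * (q (y + h) - 2 * q y + q (y - h))
    + ε * h ^ 3 * q y ^ 2 * (q (y + h) + q (y - h))

/-- Taylor's theorem for a smooth function, with big-O remainder. -/
theorem isBigO_sub_taylor_sum {f : ℝ → ℝ} (hf : ContDiff ℝ (⊤ : ℕ∞) f) (x : ℝ) (n : ℕ) :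
    (fun t : ℝ => f (x + t)
        - ∑ k ∈ Finset.range n, ((k.factorial : ℝ)⁻¹ * t ^ k) * iteratedDeriv k f x)
      =O[𝓝 (0 : ℝ)] fun t : ℝ => t ^ n := by
  have hlim : Filter.Tendsto (fun t : ℝ => x + t) (𝓝 0) (𝓝 x) := by
    simpa using (continuous_const_add x).tendsto 0
  have h₁ := ((taylor_isLittleO_univ (x₀ := x) (n := n)
    (hf.of_le (mod_cast le_top))).comp_tendsto hlim).isBigO
  have h₂ : (fun t : ℝ => ((n.factorial : ℝ)⁻¹ * iteratedDeriv n f x) * t ^ n)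
      =O[𝓝 (0 : ℝ)] fun t : ℝ => t ^ n := isBigO_const_mul_self _ _ _
  simp only [Function.comp_def, taylor_within_apply, add_sub_cancel_left,
    iteratedDerivWithin_univ, smul_eq_mul, Finset.sum_range_succ] at h₁
  refine (h₁.add h₂).congr_left fun t => ?_
  ring

/-- Rescaling the variable of a power bound at the origin. -/
theorem isBigO_pow_comp_const_mul {r : ℝ → ℝ} {n : ℕ}
    (hr : r =O[𝓝 (0 : ℝ)] fun t : ℝ => t ^ n) (c : ℝ) :
    (fun t : ℝ => r (c * t)) =O[𝓝 (0 : ℝ)] fun t : ℝ => t ^ n := by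
  have hlim : Filter.Tendsto (fun t : ℝ => c * t) (𝓝 0) (𝓝 0) := by
    simpa using (continuous_const_mul c).tendsto 0
  refine (hr.comp_tendsto hlim).trans ?_
  simpa only [Function.comp_def, mul_pow] using
    isBigO_const_mul_self (c ^ n) (fun t : ℝ => t ^ n) (𝓝 0)

/-- The odd difference approximating the third derivative. -/
theorem isBigO_third_difference {q : ℝ → ℝ} (hq : ContDiff ℝ (⊤ : ℕ∞) q) (x : ℝ) :
    (fun h : ℝ => q (x + 2 * h) - q (x - 2 * h) - 2 * (q (x + h) - q (x - h))
        - 2 * iteratedDeriv 3 q x * h ^ 3) =O[𝓝 (0 : ℝ)] fun h : ℝ => h ^ 4 := by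
  have hr := isBigO_sub_taylor_sum hq x 4
  have key := ((isBigO_pow_comp_const_mul hr 2).sub (isBigO_pow_comp_const_mul hr (-2))).sub
    ((hr.sub (isBigO_pow_comp_const_mul hr (-1))).const_mul_left 2)
  refine key.congr_left fun h => ?_
  have e₁ : x + -2 * h = x - 2 * h := by ring
  have e₂ : x + -1 * h = x - h := by ring
  simp only [Finset.sum_range_succ, Finset.sum_range_zero, e₁, e₂, Nat.factorial]
  push_cast
  ring

/-- The central difference of a smooth function. -/
theorem isBigO_central_difference {g : ℝ → ℝ} (hg : ContDiff ℝ (⊤ : ℕ∞) g) (x : ℝ) :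
    (fun h : ℝ => g (x + h) - g (x - h) - 2 * deriv g x * h)
      =O[𝓝 (0 : ℝ)] fun h : ℝ => h ^ 2 := by
  have hr := isBigO_sub_taylor_sum hg x 2
  refine (hr.sub (isBigO_pow_comp_const_mul hr (-1))).congr_left fun h => ?_
  have e : x + -1 * h = x - h := by ring
  simp only [Finset.sum_range_succ, Finset.sum_range_zero, e, Nat.factorial,
    iteratedDeriv_zero, iteratedDeriv_one]
  push_cast
  ring

/-- The central difference of the nonlinear term. -/
theorem isBigO_nonlinear_difference {q : ℝ → ℝ} (hq : ContDiff ℝ (⊤ : ℕ∞) q) (x : ℝ) :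
    (fun h : ℝ => q (x + h) ^ 2 * (q (x + 2 * h) + q x)
        - q (x - h) ^ 2 * (q x + q (x - 2 * h)) - 12 * q x ^ 2 * deriv q x * h)
      =O[𝓝 (0 : ℝ)] fun h : ℝ => h ^ 2 := by
  have hd : ∀ y, HasDerivAt q (deriv q y) y := fun y =>
    (hq.differentiable (by simp) y).hasDerivAt
  have hg : ContDiff ℝ (⊤ : ℕ∞) fun h : ℝ => q (x + h) ^ 2 * (q (x + 2 * h) + q x) := by
    fun_prop
  have h₁ : HasDerivAt (fun h : ℝ => q (x + h)) (deriv q x) 0 := by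
    have := (hd (x + 0)).comp (0 : ℝ) ((hasDerivAt_id (0 : ℝ)).const_add x)
    simpa [Function.comp_def] using this
  have h₂ : HasDerivAt (fun h : ℝ => q (x + 2 * h)) (deriv q x * 2) 0 := by
    have := (hd (x + 2 * 0)).comp (0 : ℝ)
      (((hasDerivAt_id (0 : ℝ)).const_mul 2).const_add x)
    simpa [Function.comp_def] using this
  have hderiv : deriv (fun h : ℝ => q (x + h) ^ 2 * (q (x + 2 * h) + q x)) 0
      = 6 * q x ^ 2 * deriv q x := by
    refine ((h₁.pow 2).mul (h₂.add_const (q x))).deriv.trans ?_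
    simp
    ring
  refine (isBigO_central_difference hg 0).congr_left fun h => ?_
  have e₁ : x + (0 - h) = x - h := by ring
  have e₂ : x + 2 * (0 - h) = x - 2 * h := by ring
  simp only [hderiv, zero_add, e₁, e₂]
  ring

/-- Continuum limit of the semi-discrete mKdV equation: with `Q_n = h q(x+nh)` and sign
`ε = ±1`, the right-hand side
`½(1 ± Q_n²)(E − E⁻¹)[Q_{n+1} − 2Q_n + Q_{n−1} ± Q_n²(Q_{n+1} + Q_{n−1})]`
equals `(q_{xxx} ± 6q²q_x) h⁴ + O(h⁵)` as `h → 0`. -/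
theorem sdmKdV_continuum_limit (ε : ℝ) (hε : ε = 1 ∨ ε = -1) (q : ℝ → ℝ)
    (hq : ContDiff ℝ (⊤ : ℕ∞) q) (x : ℝ) :
    (fun h : ℝ =>
        (1 / 2) * (1 + ε * h ^ 2 * q x ^ 2) * (sdmKdVP ε q h (x + h) - sdmKdVP ε q h (x - h))
          - (iteratedDeriv 3 q x + 6 * ε * q x ^ 2 * deriv q x) * h ^ 4)
      =O[𝓝 (0 : ℝ)] fun h : ℝ => h ^ 5 := by
  have hF := isBigO_third_difference hq x
  have hS := isBigO_nonlinear_difference hq x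
  have pow_mul_left : ∀ {u : ℝ → ℝ} {m : ℕ} (k : ℕ), u =O[𝓝 (0 : ℝ)] (fun h : ℝ => h ^ m) →
      (fun h : ℝ => h ^ k * u h) =O[𝓝 (0 : ℝ)] fun h : ℝ => h ^ (k + m) := fun k hu => by
    simpa only [pow_add] using (isBigO_refl (fun h : ℝ => h ^ k) (𝓝 0)).mul hu
  have hmain := ((pow_mul_left 1 hF).const_mul_left (1 / 2)).add
    ((pow_mul_left 3 hS).const_mul_left (ε / 2))
  have hlead : (fun h : ℝ => (iteratedDeriv 3 q x + 6 * ε * q x ^ 2 * deriv q x) * h ^ 4)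
      =O[𝓝 (0 : ℝ)] fun h : ℝ => h ^ 4 := isBigO_const_mul_self _ _ _
  have hle : ∀ {m : ℕ}, 5 ≤ m →
      (fun h : ℝ => h ^ m) =O[𝓝 (0 : ℝ)] fun h : ℝ => h ^ 5 := fun hm =>
    IsBigO.of_bound 1 (by
      filter_upwards [Metric.ball_mem_nhds (0 : ℝ) one_pos] with h hh
      simpa only [norm_pow, one_mul] using
        pow_le_pow_of_le_one (norm_nonneg h) (mem_ball_zero_iff.mp hh).le hm)
  have hcorr := (((pow_mul_left 2 hmain).trans (hle (by norm_num))).add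
    ((pow_mul_left 2 hlead).trans (hle (by norm_num)))).const_mul_left (ε * q x ^ 2)
  refine (hmain.add hcorr).congr_left fun h => ?_
  have e₁ : x + h + h = x + 2 * h := by ring
  have e₂ : x - h - h = x - 2 * h := by ring
  simp only [sdmKdVP, e₁, e₂, add_sub_cancel_right, sub_add_cancel]
  ring
end

section
/- Let q, r : ℝ → ℂ be infinitely differentiable and fix x ∈ ℝ. Then as h → 0, the second semi-discrete AKNS conserved density ρ̄^{(2)} = −(1/2)·Q_n·[2R_{n−2}(Q_{n−1}R_{n−1} − 1) + R_{n−1}(Q_nR_{n−1} + 2)], evaluated with Q_n = h q(x), Q_{n−1} = h q(x−h), R_{n−1} = h r(x−h), R_{n−2} = h r(x−2h), satisfies ρ̄^{(2)} + q(x)·r'(x)·h³ = O(h⁴). That is, in the continuum limit ρ̄^{(2)} = ρ^{(2)}·h³ + O(h⁴), where ρ^{(2)} = −q r_x is the second conserved density of the continuous AKNS hierarchy. -/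
open Asymptotics Topology

/-- First-order Taylor expansion of a `C²` function of a real variable, with quadratic remainder. -/
theorem ContDiff.isBigO_sub_sub_smul_deriv {E : Type*} [NormedAddCommGroup E] [NormedSpace ℝ E]
    {f : ℝ → E} (hf : ContDiff ℝ 2 f) (x : ℝ) :
    (fun y => f y - f x - (y - x) • deriv f x) =O[𝓝 x] fun y => (y - x) ^ 2 := by
  have h := (taylor_isLittleO_univ (x₀ := x) (n := 2) hf).isBigO
  have h' : (fun y : ℝ => ((2 : ℝ)⁻¹ * (y - x) ^ 2) • iteratedDeriv 2 f x)
      =O[𝓝 x] fun y => (y - x) ^ 2 := by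
    simpa using ((isBigO_refl (fun y : ℝ => (y - x) ^ 2) (𝓝 x)).const_mul_left (2 : ℝ)⁻¹).smul
      (isBigO_const_const (iteratedDeriv 2 f x) (one_ne_zero (α := ℝ)) (𝓝 x))
  refine (h.add h').congr_left fun y => ?_
  simp only [taylorWithinEval_succ, taylor_within_zero_eval, iteratedDerivWithin_univ]
  norm_num [iteratedDeriv_one]
  abel

/-- Backward difference based at a shifted point: `f (x - h) - f (x - 2h) = h f'(x) + O(h²)`. -/
theorem ContDiff.isBigO_shifted_backward_difference {E : Type*} [NormedAddCommGroup E]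
    [NormedSpace ℝ E] {f : ℝ → E} (hf : ContDiff ℝ 2 f) (x : ℝ) :
    (fun h : ℝ => f (x - h) - f (x - 2 * h) - h • deriv f x) =O[𝓝 0] fun h => h ^ 2 := by
  have key (c : ℝ) : (fun h : ℝ => f (x - c * h) - f x - (x - c * h - x) • deriv f x)
      =O[𝓝 0] fun h => h ^ 2 := by
    have ht : Filter.Tendsto (fun h : ℝ => x - c * h) (𝓝 0) (𝓝 x) :=
      Continuous.tendsto' (by fun_prop) _ _ (by simp)
    refine ((hf.isBigO_sub_sub_smul_deriv x).comp_tendsto ht).trans ?_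
    refine ((isBigO_refl (fun h : ℝ => h ^ 2) (𝓝 0)).const_mul_left (c ^ 2)).congr_left fun h => ?_
    simp only [Function.comp_apply]
    ring
  refine ((key 1).sub (key 2)).congr_left fun h => ?_
  rw [one_mul]
  module

/-- Continuum limit of the second semi-discrete AKNS conserved density
`ρ̄⁽²⁾ = −½ Q_n [2R_{n−2}(Q_{n−1}R_{n−1} − 1) + R_{n−1}(Q_n R_{n−1} + 2)]`, with
`Q_{n−k} = h q(x − kh)`, `R_{n−k} = h r(x − kh)`:
`ρ̄⁽²⁾ = (−q r_x) h³ + O(h⁴)` as `h → 0`. -/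
theorem sdAKNS_second_density_continuum_limit (q r : ℝ → ℂ)
    (hq : ContDiff ℝ (⊤ : ℕ∞) q) (hr : ContDiff ℝ (⊤ : ℕ∞) r) (x : ℝ) :
    (fun h : ℝ =>
        -(1 / 2 : ℂ) * ((h : ℂ) * q x) *
            (2 * ((h : ℂ) * r (x - 2 * h)) * (((h : ℂ) * q (x - h)) * ((h : ℂ) * r (x - h)) - 1)
              + ((h : ℂ) * r (x - h)) * (((h : ℂ) * q x) * ((h : ℂ) * r (x - h)) + 2))
          + q x * deriv r x * (h : ℂ) ^ 3)
      =O[𝓝 (0 : ℝ)] fun h : ℝ => h ^ 4 := by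
  have hd := (contDiff_infty.mp hr 2).isBigO_shifted_backward_difference x
  have hqc := hq.continuous
  have hrc := hr.continuous
  have hid : (fun h : ℝ => (h : ℂ)) =O[𝓝 0] fun h : ℝ => h :=
    .of_norm_right (.of_norm_le fun h => by simp)
  have hcubic : (fun h : ℝ => -q x * (h : ℂ) ^ 2 *
      (r (x - h) - r (x - 2 * h) - h • deriv r x)) =O[𝓝 0] fun h : ℝ => h ^ 4 :=
    (((hid.pow 2).const_mul_left (-q x)).mul hd).congr_right fun h => by ring
  have hbdd : (fun h : ℝ => -(1 / 2 : ℂ) * q x *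
      (2 * r (x - 2 * h) * q (x - h) * r (x - h) + q x * r (x - h) ^ 2))
      =O[𝓝 0] fun _ => (1 : ℝ) :=
    (Continuous.tendsto (by fun_prop) 0).isBigO_one ℝ
  have hquartic := ((hid.pow 4).mul hbdd).congr_right fun h => mul_one (h ^ 4)
  refine (hcubic.add hquartic).congr_left fun h => ?_
  rw [Complex.real_smul]
  ring
end

section
/- Let q, r : ℝ → ℂ be infinitely differentiable and fix x ∈ ℝ. Then as h → 0, the third semi-discrete AKNS conserved density ρ̄^{(3)} = (1/3)Q_n³R_{n−1}³ + Q_n²R_{n−1}[R_{n−1} + R_{n−2}(Q_{n−1}R_{n−1} − 1)] + Q_n[R_{n−1} + 2R_{n−2}(Q_{n−1}R_{n−1} − 1) + Q_{n−1}R_{n−2}²(Q_{n−1}R_{n−1} − 1) + R_{n−3}(Q_{n−2}R_{n−2} − 1)(Q_{n−1}R_{n−1} − 1)], evaluated with Q_{n−k} = h q(x−kh) and R_{n−k} = h r(x−kh), satisfies ρ̄^{(3)} − (q(x)r''(x) − q(x)²r(x)²)·h⁴ = O(h⁵). That is, in the continuum limit ρ̄^{(3)} = ρ^{(3)}·h⁴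 + O(h⁵), where ρ^{(3)} = q r_{xx} − q²r² is the third conserved density of the continuous AKNS hierarchy. -/
open Asymptotics Topology

open Filter in
/-- Second-order Taylor expansion of a `C³` function along the points `x - c * h`. -/
theorem isBigO_taylor_two_sub_const_mul {f : ℝ → ℂ} (hf : ContDiff ℝ 3 f) (x c : ℝ) :
    (fun h : ℝ => f (x - c * h) - (f x - c * h * deriv f x + (c * h) ^ 2 / 2 * deriv (deriv f) x))
      =O[𝓝 0] fun h : ℝ => h ^ 3 := by
  have taylor : (fun y : ℝ => f y - (f x + ((y - x : ℝ) : ℂ) * deriv f x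
      + ((y - x : ℝ) : ℂ) ^ 2 / 2 * deriv (deriv f) x)) =O[𝓝 x] fun y => (y - x) ^ 3 := by
    have hcubic : (fun y : ℝ => ((y - x) ^ 3 / 6) • iteratedDeriv 3 f x)
        =O[𝓝 x] fun y => (y - x) ^ 3 :=
      IsBigO.of_bound ‖iteratedDeriv 3 f x‖ <| .of_forall fun y => by
        rw [norm_smul, norm_div, mul_comm]
        gcongr
        exact div_le_self (norm_nonneg _) (by norm_num)
    refine ((taylor_isLittleO_univ (x₀ := x) (n := 3) hf).isBigO.add hcubic).congr_left fun y => ?_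
    simp only [taylorWithinEval_succ, taylor_within_zero_eval, iteratedDerivWithin_univ,
      iteratedDeriv_succ, iteratedDeriv_zero, Complex.real_smul]
    push_cast [Nat.factorial]
    ring
  have hlim : Tendsto (fun h : ℝ => x - c * h) (𝓝 0) (𝓝 x) := by
    have : Continuous fun h : ℝ => x - c * h := by fun_prop
    simpa using this.tendsto 0
  refine ((taylor.comp_tendsto hlim).congr_left fun h => ?_).trans
    (IsBigO.of_bound (‖c‖ ^ 3) <| .of_forall fun h => ?_)
  · simp only [Function.comp_apply]
    push_cast
    ring
  · simp [mul_pow]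

/-- The second difference of a `C³` function on the backward stencil `x - h, x - 2h, x - 3h`
approximates `h² f''(x)` up to `O(h³)`. -/
theorem isBigO_backward_second_difference {f : ℝ → ℂ} (hf : ContDiff ℝ 3 f) (x : ℝ) :
    (fun h : ℝ => f (x - h) - 2 * f (x - 2 * h) + f (x - 3 * h)
      - (h : ℂ) ^ 2 * deriv (deriv f) x) =O[𝓝 0] fun h : ℝ => h ^ 3 := by
  refine (((isBigO_taylor_two_sub_const_mul hf x 1).sub
    ((isBigO_taylor_two_sub_const_mul hf x 2).const_mul_left 2)).add
    (isBigO_taylor_two_sub_const_mul hf x 3)).congr_left fun h => ?_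
  simp only [one_mul]
  push_cast
  ring

/-- Continuum limit of the third semi-discrete AKNS conserved density
`ρ̄⁽³⁾ = ⅓Q_n³R_{n−1}³ + Q_n²R_{n−1}[R_{n−1} + R_{n−2}(Q_{n−1}R_{n−1} − 1)]
  + Q_n[R_{n−1} + 2R_{n−2}(Q_{n−1}R_{n−1} − 1) + Q_{n−1}R_{n−2}²(Q_{n−1}R_{n−1} − 1)
        + R_{n−3}(Q_{n−2}R_{n−2} − 1)(Q_{n−1}R_{n−1} − 1)]`,
with `Q_{n−k} = h q(x − kh)`, `R_{n−k} = h r(x − kh)`: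
`ρ̄⁽³⁾ = (q r_{xx} − q²r²) h⁴ + O(h⁵)` as `h → 0`. -/
theorem sdAKNS_third_density_continuum_limit (q r : ℝ → ℂ)
    (hq : ContDiff ℝ (⊤ : ℕ∞) q) (hr : ContDiff ℝ (⊤ : ℕ∞) r) (x : ℝ) :
    (fun h : ℝ =>
        (let Q0 : ℂ := (h : ℂ) * q x
         let Q1 : ℂ := (h : ℂ) * q (x - h)
         let Q2 : ℂ := (h : ℂ) * q (x - 2 * h)
         let R1 : ℂ := (h : ℂ) * r (x - h)
         let R2 : ℂ := (h : ℂ) * r (x - 2 * h)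
         let R3 : ℂ := (h : ℂ) * r (x - 3 * h)
         (1 / 3) * Q0 ^ 3 * R1 ^ 3
           + Q0 ^ 2 * R1 * (R1 + R2 * (Q1 * R1 - 1))
           + Q0 * (R1 + 2 * R2 * (Q1 * R1 - 1) + Q1 * R2 ^ 2 * (Q1 * R1 - 1)
               + R3 * (Q2 * R2 - 1) * (Q1 * R1 - 1)))
          - (q x * deriv (deriv r) x - q x ^ 2 * r x ^ 2) * (h : ℂ) ^ 4)
      =O[𝓝 (0 : ℝ)] fun h : ℝ => h ^ 5 := by
  have hq1 : Differentiable ℝ q := hq.differentiable (by simp)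
  have hr1 : Differentiable ℝ r := hr.differentiable (by simp)
  have hpow (n : ℕ) : (fun h : ℝ => (h : ℂ) ^ n) =O[𝓝 0] fun h : ℝ => h ^ n :=
    IsBigO.of_bound 1 <| .of_forall fun h => by simp
  have hdiff := isBigO_backward_second_difference (contDiff_infty.1 hr 3) x
  let quartic : ℝ → ℂ := fun h =>
    q x ^ 2 * r (x - h) * (r (x - h) - r (x - 2 * h))
      + q x * (2 * r (x - 2 * h) * q (x - h) * r (x - h) - q (x - h) * r (x - 2 * h) ^ 2
        - r (x - 3 * h) * (q (x - 2 * h) * r (x - 2 * h) + q (x - h) * r (x - h)))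
      + q x ^ 2 * r x ^ 2
  let sextic : ℝ → ℂ := fun h =>
    (1 / 3) * q x ^ 3 * r (x - h) ^ 3
      + q x ^ 2 * r (x - h) * r (x - 2 * h) * q (x - h) * r (x - h)
      + q x * (q (x - h) * r (x - 2 * h) ^ 2 * q (x - h) * r (x - h)
        + r (x - 3 * h) * q (x - 2 * h) * r (x - 2 * h) * q (x - h) * r (x - h))
  have hquartic : quartic =O[𝓝 0] fun h : ℝ => h := by
    have hd : Differentiable ℝ quartic := by unfold quartic; fun_prop
    have h0 : quartic 0 = 0 := by simp only [quartic, mul_zero, sub_zero]; ring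
    simpa [h0] using (hd 0).isBigO_sub
  have hsextic : (fun h : ℝ => (h : ℂ) ^ 2 * sextic h) =O[𝓝 0] fun h : ℝ => h := by
    have hd : Differentiable ℝ fun h : ℝ => (h : ℂ) ^ 2 * sextic h := by
      have : Differentiable ℝ fun h : ℝ => (h : ℂ) := Complex.ofRealCLM.differentiable
      unfold sextic
      fun_prop
    simpa using (hd 0).isBigO_sub
  have h2 := ((hpow 2).mul hdiff).const_mul_left (q x)
  have h46 := (hpow 4).mul (hquartic.add hsextic)
  simp only [← pow_add, ← pow_succ] at h2 h46
  refine (h2.add h46).congr_left fun h => ?_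
  simp only [quartic, sextic]
  ring
end
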